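/- arXiv:1304.4309 — 3 statements merged into one kernel-verified Lean document; each statement's English description precedes it below -/
import Mathlib

section
/- Define f(n;A,B) to be the number of marked set partitions λ of [n] with o(λ) = A open blocks and d̃(λ) = B (for n = 0 set f(0;0,0) = 1 and f(0;A,B) = 0 for (A,B) ≠ (0,0); also f(n;A,B) = 0 when no such marked partition exists). Then for all n ≥ 1 and all integers A ≥ 0 and B: f(n;A,B) = f(n−1; A−1, B−A+1) + f(n−1; A, B−A) + A·f(n−1; A, B−A+1) + (A+1)·f(n−1; A+1, B−A). -/
open Finset

/-- Set partitions of `[n]`, modeled as finpartitions of `Fin n`. -/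
abbrev SetPartition (n : ℕ) := Finpartition (Finset.univ : Finset (Fin n))

/-- The `n`-th Bell number: the number of set partitions of `[n]`. -/
def bell (n : ℕ) : ℕ := Fintype.card (SetPartition n)

/-- `i` and `j` lie in the same block of the partition. -/
def SameBlock {n : ℕ} (P : SetPartition n) (i j : Fin n) : Prop :=
  ∃ b ∈ P.parts, i ∈ b ∧ j ∈ b

/-- `i` is the smallest element of its block. -/
def IsFirst {n : ℕ} (P : SetPartition n) (i : Fin n) : Prop :=
  ∀ j, SameBlock P i j → i ≤ j

/-- `i` is the largest element of its block. -/
def IsLast {n : ℕ} (P : SetPartition n) (i : Fin n) : Prop :=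
  ∀ j, SameBlock P i j → j ≤ i

/-- `(i, j)` is an arc: `i < j`, both in the same block, and `j` is the smallest
element of that block greater than `i`. -/
def IsArc {n : ℕ} (P : SetPartition n) (i j : Fin n) : Prop :=
  i < j ∧ SameBlock P i j ∧ ∀ k, i < k → k < j → ¬ SameBlock P i k

/-- The dimension exponent `d(λ) = Σ_blocks (max - min + 1) - n`. -/
def dimExp {n : ℕ} (P : SetPartition n) : ℤ :=
  (∑ b ∈ P.parts.attach,
      (((b.1.max' (P.nonempty_of_mem_parts b.2)).val : ℤ)
        - ((b.1.min' (P.nonempty_of_mem_parts b.2)).val : ℤ) + 1)) - n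

/-- The intertwining exponent (number of 2-crossings): the number of pairs of arcs
`(i₁,j₁), (i₂,j₂)` with `i₁ < i₂ < j₁ < j₂`. -/
noncomputable def inter {n : ℕ} (P : SetPartition n) : ℕ :=
  Set.ncard {q : (Fin n × Fin n) × (Fin n × Fin n) |
    IsArc P q.1.1 q.1.2 ∧ IsArc P q.2.1 q.2.2 ∧
    q.1.1 < q.2.1 ∧ q.2.1 < q.1.2 ∧ q.1.2 < q.2.2}

/-- A marked set partition of `[n]`: a set partition together with a designation of
each block as open or closed (`opens` is the set of open blocks). -/
structure MarkedPartition (n : ℕ) where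
  part : SetPartition n
  opens : Finset (Finset (Fin n))
  opens_subset : opens ⊆ part.parts

/-- The number of open blocks. -/
def MarkedPartition.o {n : ℕ} (μ : MarkedPartition n) : ℕ := μ.opens.card

/-- The generalized dimension exponent of a marked set partition:
`d̃(λ) = (Σ_{closed blocks} max B) - (Σ_{all blocks} min B) + ℓ(λ) + n(o(λ) - 1)`,
where elements of `[n] = {1, …, n}` are identified with `x.val + 1` for `x : Fin n`. -/
def MarkedPartition.dtilde {n : ℕ} (μ : MarkedPartition n) : ℤ :=
  (∑ b ∈ (μ.part.parts \ μ.opens).attach,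
      (((b.1.max' (μ.part.nonempty_of_mem_parts (Finset.mem_sdiff.mp b.2).1)).val : ℤ) + 1))
  - (∑ b ∈ μ.part.parts.attach,
      (((b.1.min' (μ.part.nonempty_of_mem_parts b.2)).val : ℤ) + 1))
  + μ.part.parts.card + (n : ℤ) * ((μ.o : ℤ) - 1)

noncomputable instance markedPartitionFintype (n : ℕ) : Fintype (MarkedPartition n) :=
  Fintype.ofInjective (fun μ => (μ.part, μ.opens)) (by
    rintro ⟨p₁, o₁, h₁⟩ ⟨p₂, o₂, h₂⟩ h
    simpa using h)

/-- `f(n; A, B)`: the number of marked set partitions of `[n]` with `A` open blocks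
and generalized dimension exponent `B`. -/
noncomputable def fdim (n : ℕ) (A B : ℤ) : ℕ :=
  Nat.card {μ : MarkedPartition n // (μ.o : ℤ) = A ∧ μ.dtilde = B}

namespace MarkedPartition

/-- The copy of a subset of `[n]` inside `[n + 1]`. -/
def up {n : ℕ} (s : Finset (Fin n)) : Finset (Fin (n + 1)) := s.map Fin.castSuccEmb

/-- The copy of a subset of `[n]` inside `[n + 1]`, with the new largest element added. -/
def upLast {n : ℕ} (s : Finset (Fin n)) : Finset (Fin (n + 1)) := insert (Fin.last n) (up s)

/-- The trace on `[n]` of a subset of `[n + 1]`. -/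
def down {n : ℕ} (t : Finset (Fin (n + 1))) : Finset (Fin n) :=
  univ.filter fun x => x.castSucc ∈ t

section UpDown

variable {n : ℕ}

@[simp] lemma castSucc_mem_up {s : Finset (Fin n)} {x : Fin n} : x.castSucc ∈ up s ↔ x ∈ s := by
  simp [up]

@[simp] lemma last_notMem_up (s : Finset (Fin n)) : Fin.last n ∉ up s := by
  simp [up, Fin.castSucc_ne_last]

@[simp] lemma last_mem_upLast (s : Finset (Fin n)) : Fin.last n ∈ upLast s := by
  simp [upLast]

@[simp] lemma castSucc_mem_upLast {s : Finset (Fin n)} {x : Fin n} :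
    x.castSucc ∈ upLast s ↔ x ∈ s := by
  simp [upLast, Fin.castSucc_ne_last]

@[simp] lemma mem_down {t : Finset (Fin (n + 1))} {x : Fin n} : x ∈ down t ↔ x.castSucc ∈ t := by
  simp [down]

@[simp] lemma down_up (s : Finset (Fin n)) : down (up s) = s := by ext; simp

@[simp] lemma down_upLast (s : Finset (Fin n)) : down (upLast s) = s := by ext; simp

lemma up_down {t : Finset (Fin (n + 1))} (h : Fin.last n ∉ t) : up (down t) = t := by
  ext x
  refine Fin.lastCases ?_ (fun x => ?_) x <;> simp [h]

lemma upLast_down {t : Finset (Fin (n + 1))} (h : Fin.last n ∈ t) : upLast (down t) = t := by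
  ext x
  refine Fin.lastCases ?_ (fun x => ?_) x <;> simp [h]

lemma up_injective : Function.Injective (up (n := n)) :=
  Function.LeftInverse.injective down_up

lemma upLast_injective : Function.Injective (upLast (n := n)) :=
  Function.LeftInverse.injective down_upLast

@[simp] lemma up_ne_upLast (s t : Finset (Fin n)) : up s ≠ upLast t := fun h =>
  last_notMem_up s (h ▸ last_mem_upLast t)

@[simp] lemma upLast_ne_up (s t : Finset (Fin n)) : upLast s ≠ up t := (up_ne_upLast t s).symm

end UpDown

/-- The largest element of a nonempty block, in the `1`-based labelling. -/
def maxLabel {n : ℕ} (s : Finset (Fin n)) : ℤ :=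
  if h : s.Nonempty then ((s.max' h).val : ℤ) + 1 else 0

/-- The smallest element of a nonempty block, in the `1`-based labelling. -/
def minLabel {n : ℕ} (s : Finset (Fin n)) : ℤ :=
  if h : s.Nonempty then ((s.min' h).val : ℤ) + 1 else 0

section Labels

variable {n : ℕ}

lemma maxLabel_eq {s : Finset (Fin n)} {x : Fin n} (hx : x ∈ s) (h : ∀ y ∈ s, y ≤ x) :
    maxLabel s = (x.val : ℤ) + 1 := by
  have hs : s.Nonempty := ⟨x, hx⟩
  have : s.max' hs = x := le_antisymm (s.max'_le hs x h) (s.le_max' x hx)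
  simp [maxLabel, hs, this]

lemma minLabel_eq {s : Finset (Fin n)} {x : Fin n} (hx : x ∈ s) (h : ∀ y ∈ s, x ≤ y) :
    minLabel s = (x.val : ℤ) + 1 := by
  have hs : s.Nonempty := ⟨x, hx⟩
  have : s.min' hs = x := le_antisymm (s.min'_le x hx) (s.le_min' hs x h)
  simp [minLabel, hs, this]

@[simp] lemma maxLabel_up (s : Finset (Fin n)) : maxLabel (up s) = maxLabel s := by
  rcases s.eq_empty_or_nonempty with rfl | hs
  · simp [maxLabel, up]
  · rw [maxLabel_eq (x := (s.max' hs).castSucc) (by simp [s.max'_mem hs]),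
      maxLabel_eq (s.max'_mem hs) fun y hy => s.le_max' y hy]
    · simp
    · intro y
      refine Fin.lastCases (by simp) (fun y => ?_) y
      simpa using s.le_max' y

@[simp] lemma minLabel_up (s : Finset (Fin n)) : minLabel (up s) = minLabel s := by
  rcases s.eq_empty_or_nonempty with rfl | hs
  · simp [minLabel, up]
  · rw [minLabel_eq (x := (s.min' hs).castSucc) (by simp [s.min'_mem hs]),
      minLabel_eq (s.min'_mem hs) fun y hy => s.min'_le y hy]
    · simp
    · intro y
      refine Fin.lastCases (by simp) (fun y => ?_) y
      simpa using s.min'_le y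

lemma maxLabel_upLast (s : Finset (Fin n)) : maxLabel (upLast s) = n + 1 := by
  rw [maxLabel_eq (last_mem_upLast s) fun y _ => Fin.le_last y]
  simp

lemma minLabel_upLast_empty : minLabel (upLast (∅ : Finset (Fin n))) = n + 1 := by
  rw [minLabel_eq (last_mem_upLast ∅)]
  · simp
  · intro y
    refine Fin.lastCases (by simp) (fun y => ?_) y
    simp

lemma minLabel_upLast {s : Finset (Fin n)} (hs : s.Nonempty) :
    minLabel (upLast s) = minLabel s := by
  rw [minLabel_eq (x := (s.min' hs).castSucc) (by simp [s.min'_mem hs]),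
    minLabel_eq (s.min'_mem hs) fun y hy => s.min'_le y hy]
  · simp
  · intro y
    refine Fin.lastCases (fun _ => Fin.le_last _) (fun y => ?_) y
    simpa using s.min'_le y

end Labels

variable {n : ℕ}

lemma dtilde_eq (μ : MarkedPartition n) :
    μ.dtilde = ∑ b ∈ μ.part.parts \ μ.opens, maxLabel b - ∑ b ∈ μ.part.parts, minLabel b
      + μ.part.parts.card + (n : ℤ) * ((μ.o : ℤ) - 1) := by
  rw [dtilde, ← Finset.sum_attach (μ.part.parts \ μ.opens), ← Finset.sum_attach μ.part.parts]
  congr 3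
  · refine Finset.sum_congr rfl fun b _ => ?_
    rw [maxLabel, dif_pos (μ.part.nonempty_of_mem_parts (Finset.mem_sdiff.mp b.2).1)]
  · refine Finset.sum_congr rfl fun b _ => ?_
    rw [minLabel, dif_pos (μ.part.nonempty_of_mem_parts b.2)]

@[ext] lemma ext {μ ν : MarkedPartition n} (h : μ.part.parts = ν.part.parts)
    (h' : μ.opens = ν.opens) : μ = ν := by
  obtain ⟨p, _, _⟩ := μ
  obtain ⟨q, _, _⟩ := ν
  obtain rfl : p = q := Finpartition.ext h
  obtain rfl := h'
  rfl

lemma empty_notMem_parts (μ : MarkedPartition n) : ∅ ∉ μ.part.parts := μ.part.bot_notMem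

lemma empty_notMem_opens (μ : MarkedPartition n) : ∅ ∉ μ.opens := fun h =>
  μ.empty_notMem_parts (μ.opens_subset h)

/-- Two blocks of a marked partition sharing an element agree. -/
lemma eq_of_mem (μ : MarkedPartition n) {s t : Finset (Fin n)} (hs : s ∈ μ.part.parts)
    (ht : t ∈ μ.part.parts) {x : Fin n} (hxs : x ∈ s) (hxt : x ∈ t) : s = t :=
  μ.part.eq_of_mem_parts hs ht hxs hxt

/-- The blocks obtained by joining the new element `n + 1` to `b`, where `b` is either a block
or empty. -/
def extendParts (P : Finset (Finset (Fin n))) (b : Finset (Fin n)) :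
    Finset (Finset (Fin (n + 1))) :=
  insert (upLast b) ((P.erase b).image up)

/-- The marked partition of `[n + 1]` obtained by joining the new element to the open block `b`,
or by making it a singleton when `b = ∅`; the resulting block is open if and only if `c`. -/
def extend (μ : MarkedPartition n) (b : Finset (Fin n)) (hb : b ∈ insert ∅ μ.opens) (c : Bool) :
    MarkedPartition (n + 1) where
  part := Finpartition.ofExistsUnique (extendParts μ.part.parts b) (fun _ _ => subset_univ _)
    (by
      intro x _
      refine Fin.lastCases ?_ (fun x => ?_) x
      · refine ⟨upLast b, by simp [extendParts], ?_⟩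
        rintro t ⟨ht, hx⟩
        simp only [extendParts, mem_insert, mem_image] at ht
        rcases ht with rfl | ⟨s, -, rfl⟩
        · rfl
        · simp at hx
      · by_cases hxb : x ∈ b
        · have hbP : b ∈ μ.part.parts := by
            rcases mem_insert.1 hb with rfl | h
            · simp at hxb
            · exact μ.opens_subset h
          refine ⟨upLast b, by simp [extendParts, hxb], ?_⟩
          rintro t ⟨ht, hx⟩
          simp only [extendParts, mem_insert, mem_image, mem_erase] at ht
          rcases ht with rfl | ⟨s, ⟨hsb, hs⟩, rfl⟩
          · rfl
          · exact absurd (μ.eq_of_mem hs hbP (castSucc_mem_up.1 hx) hxb) hsb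
        · obtain ⟨s, hs, hxs⟩ := μ.part.exists_mem (mem_univ x)
          have hsb : s ≠ b := by rintro rfl; exact hxb hxs
          refine ⟨up s, ⟨?_, by simpa using hxs⟩, ?_⟩
          · exact mem_insert_of_mem (mem_image_of_mem _ (mem_erase.2 ⟨hsb, hs⟩))
          rintro t ⟨ht, hx⟩
          simp only [extendParts, mem_insert, mem_image, mem_erase] at ht
          rcases ht with rfl | ⟨s', ⟨-, hs'⟩, rfl⟩
          · exact absurd (castSucc_mem_upLast.1 hx) hxb
          · rw [μ.eq_of_mem hs' hs (castSucc_mem_up.1 hx) hxs])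
    (by
      intro h
      simp only [extendParts, mem_insert, mem_image, mem_erase] at h
      rcases h with h | ⟨s, ⟨-, hs⟩, h⟩
      · exact absurd (last_mem_upLast b) (by simp [← h])
      · refine μ.part.ne_bot hs ?_
        rw [← down_up s, h]
        ext; simp)
  opens := if c then extendParts μ.opens b else (μ.opens.erase b).image up
  opens_subset := by
    have h : (μ.opens.erase b).image up ⊆ (μ.part.parts.erase b).image up :=
      image_subset_image (erase_subset_erase _ μ.opens_subset)
    cases c
    · exact h.trans (subset_insert _ _)
    · exact insert_subset_insert _ h

section Extend

variable (μ : MarkedPartition n) (b : Finset (Fin n)) (hb : b ∈ insert ∅ μ.opens) (c : Bool)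

lemma extend_parts : (μ.extend b hb c).part.parts = extendParts μ.part.parts b := rfl

lemma extend_opens : (μ.extend b hb c).opens =
    if c then extendParts μ.opens b else (μ.opens.erase b).image up := rfl

lemma upLast_notMem_image_up (P : Finset (Finset (Fin n))) : upLast b ∉ P.image up := by
  simp

lemma sum_extendParts (P : Finset (Finset (Fin n))) (f : Finset (Fin (n + 1)) → ℤ) :
    ∑ s ∈ extendParts P b, f s = f (upLast b) + ∑ s ∈ P.erase b, f (up s) := by
  rw [extendParts, sum_insert (upLast_notMem_image_up b _), sum_image up_injective.injOn]

lemma card_extendParts (P : Finset (Finset (Fin n))) :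
    (extendParts P b).card = (P.erase b).card + 1 := by
  rw [extendParts, card_insert_of_notMem (upLast_notMem_image_up b _),
    card_image_of_injective _ up_injective]

lemma erase_sdiff_erase {μ : MarkedPartition n} {b : Finset (Fin n)} (hb : b ∈ insert ∅ μ.opens) :
    μ.part.parts.erase b \ μ.opens.erase b = μ.part.parts \ μ.opens := by
  ext s
  have h₀ := μ.empty_notMem_parts
  simp only [mem_sdiff, mem_erase, mem_insert] at hb ⊢
  by_cases hs : s = b
  · subst hs
    rcases hb with rfl | hb <;> simp_all
  · simp [hs]

lemma extend_closed_true : (μ.extend b hb true).part.parts \ (μ.extend b hb true).opens =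
    (μ.part.parts \ μ.opens).image up := by
  rw [← erase_sdiff_erase hb, image_sdiff _ _ up_injective]
  simp only [extend_parts, extend_opens, extendParts, if_true]
  rw [insert_sdiff_insert, sdiff_insert_of_notMem (upLast_notMem_image_up b _)]

lemma extend_closed_false : (μ.extend b hb false).part.parts \ (μ.extend b hb false).opens =
    insert (upLast b) ((μ.part.parts \ μ.opens).image up) := by
  rw [← erase_sdiff_erase hb, image_sdiff _ _ up_injective]
  simp only [extend_parts, extend_opens, extendParts, Bool.false_eq_true, if_false]
  rw [insert_sdiff_of_notMem _ (upLast_notMem_image_up b _)]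

lemma sum_maxLabel_closed_extend :
    ∑ s ∈ (μ.extend b hb c).part.parts \ (μ.extend b hb c).opens, maxLabel s =
      ∑ s ∈ μ.part.parts \ μ.opens, maxLabel s + if c then 0 else (n : ℤ) + 1 := by
  cases c
  · rw [extend_closed_false, sum_insert (upLast_notMem_image_up b _),
      sum_image up_injective.injOn, maxLabel_upLast]
    simp [add_comm]
  · rw [extend_closed_true, sum_image up_injective.injOn]
    simp

lemma o_extend : (μ.extend b hb c).o = (μ.opens.erase b).card + if c then 1 else 0 := by
  cases c
  · simp [o, extend_opens, card_image_of_injective _ up_injective]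
  · simp [o, extend_opens, card_extendParts]

lemma o_extend_empty (h : ∅ ∈ insert ∅ μ.opens) :
    ((μ.extend ∅ h c).o : ℤ) = μ.o + if c then 1 else 0 := by
  rw [o_extend, erase_eq_of_notMem μ.empty_notMem_opens]
  simp [o]

lemma o_extend_of_mem (hb' : b ∈ μ.opens) :
    ((μ.extend b hb c).o : ℤ) = μ.o + if c then 0 else -1 := by
  have h := card_erase_add_one hb'
  rw [o_extend, o, ← h]
  cases c <;> simp

lemma dtilde_extend_empty (h : ∅ ∈ insert ∅ μ.opens) :
    (μ.extend ∅ h c).dtilde = μ.dtilde + μ.o := by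
  rw [dtilde_eq, dtilde_eq, sum_maxLabel_closed_extend, o_extend_empty, extend_parts,
    sum_extendParts, card_extendParts, erase_eq_of_notMem μ.empty_notMem_parts,
    minLabel_upLast_empty]
  simp only [minLabel_up]
  cases c <;> simp <;> ring

lemma dtilde_extend_of_mem (hb' : b ∈ μ.opens) :
    (μ.extend b hb c).dtilde = μ.dtilde + μ.o - 1 := by
  have hP := μ.opens_subset hb'
  rw [dtilde_eq, dtilde_eq, sum_maxLabel_closed_extend, o_extend_of_mem _ _ _ _ hb', extend_parts,
    sum_extendParts, card_extendParts, minLabel_upLast (μ.part.nonempty_of_mem_parts hP),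
    card_erase_add_one hP]
  simp only [minLabel_up]
  rw [add_sum_erase _ minLabel hP]
  cases c <;> simp <;> ring

end Extend

/-- The data from which a marked partition of `[n + 1]` is built by `extend`. -/
abbrev ExtensionData (n : ℕ) :=
  Σ μ : MarkedPartition n, {b : Finset (Fin n) // b ∈ insert ∅ μ.opens} × Bool

/-- `extend` as a map on `ExtensionData`. -/
def extendMap (n : ℕ) (d : ExtensionData n) : MarkedPartition (n + 1) :=
  d.1.extend d.2.1.1 d.2.1.2 d.2.2

lemma mem_extendParts_up {P : Finset (Finset (Fin n))} {b s : Finset (Fin n)} :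
    up s ∈ extendParts P b ↔ s ≠ b ∧ s ∈ P := by
  simp [extendParts, up_injective.eq_iff]

lemma mem_extendParts_upLast {P : Finset (Finset (Fin n))} {b s : Finset (Fin n)} :
    upLast s ∈ extendParts P b ↔ s = b := by
  simp [extendParts, upLast_injective.eq_iff]

lemma extendMap_injective (n : ℕ) : Function.Injective (extendMap n) := by
  rintro ⟨μ, ⟨b, hb⟩, c⟩ ⟨μ', ⟨b', hb'⟩, c'⟩ h
  have hp : extendParts μ.part.parts b = extendParts μ'.part.parts b' :=
    congrArg (fun ν => ν.part.parts) h
  have ho : (μ.extend b hb c).opens = (μ'.extend b' hb' c').opens :=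
    congrArg (fun ν => ν.opens) h
  obtain rfl : b = b' := by
    rw [← mem_extendParts_upLast (P := μ'.part.parts), ← hp, mem_extendParts_upLast]
  have key (ν : MarkedPartition n) (hν : b ∈ insert ∅ ν.opens) (e : Bool) :
      (upLast b ∈ (ν.extend b hν e).opens ↔ e = true) ∧
      ∀ s, up s ∈ (ν.extend b hν e).opens ↔ s ≠ b ∧ s ∈ ν.opens := by
    cases e <;> simp [extend_opens, extendParts, up_injective.eq_iff]
  obtain rfl : c = c' := by
    rw [Bool.eq_iff_iff, ← (key μ hb c).1, ho, (key μ' hb' c').1]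
  have hmem (ν : MarkedPartition n) (hν : b ∈ insert ∅ ν.opens) :
      (b ∈ ν.part.parts ↔ b ≠ ∅) ∧ (b ∈ ν.opens ↔ b ≠ ∅) := by
    have h₁ := ν.empty_notMem_opens
    have h₂ := ν.empty_notMem_parts
    have h₃ := @ν.opens_subset b
    rcases mem_insert.1 hν with rfl | hν
    · simp [h₁, h₂]
    · have : b ≠ ∅ := by rintro rfl; exact h₁ hν
      simp [hν, h₃ hν, this]
  obtain rfl : μ = μ' := by
    ext s
    · by_cases hs : s = b
      · rw [hs, (hmem μ hb).1, (hmem μ' hb').1]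
      · have := mem_extendParts_up (P := μ.part.parts) (b := b) (s := s)
        rw [hp, mem_extendParts_up] at this
        simpa [hs] using this.symm
    · by_cases hs : s = b
      · rw [hs, (hmem μ hb).2, (hmem μ' hb').2]
      · have := (key μ hb c).2 s
        rw [ho, (key μ' hb' c).2] at this
        simpa [hs] using this.symm
  rfl

/-- The marked partition of `[n]` obtained by deleting the largest element of `[n + 1]`, where
the block that contained it becomes open. -/
def restrict (ν : MarkedPartition (n + 1)) : MarkedPartition n where
  part := Finpartition.ofExistsUnique
    (univ.filter fun s => s ≠ ∅ ∧ (up s ∈ ν.part.parts ∨ upLast s ∈ ν.part.parts))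
    (fun _ _ => subset_univ _)
    (by
      intro x _
      obtain ⟨t, ht, hxt⟩ := ν.part.exists_mem (mem_univ x.castSucc)
      refine ⟨down t, ⟨?_, by simpa using hxt⟩, ?_⟩
      · have : down t ≠ ∅ := Nonempty.ne_empty ⟨x, by simpa using hxt⟩
        by_cases hl : Fin.last n ∈ t
        · simp [this, upLast_down hl, ht]
        · simp [this, up_down hl, ht]
      · rintro s ⟨hs, hxs⟩
        simp only [mem_filter, mem_univ, true_and] at hs
        rcases hs.2 with h | h
        · rw [← ν.eq_of_mem h ht (castSucc_mem_up.2 hxs) hxt, down_up]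
        · rw [← ν.eq_of_mem h ht (castSucc_mem_upLast.2 hxs) hxt, down_upLast])
    (by simp)
  opens := univ.filter fun s => s ≠ ∅ ∧ (up s ∈ ν.opens ∨ upLast s ∈ ν.part.parts)
  opens_subset := by
    intro s
    simp only [Finpartition.ofExistsUnique, mem_filter, mem_univ, true_and]
    exact fun h => ⟨h.1, h.2.imp_left fun h' => ν.opens_subset h'⟩

lemma mem_restrict_parts {ν : MarkedPartition (n + 1)} {s : Finset (Fin n)} :
    s ∈ ν.restrict.part.parts ↔ s ≠ ∅ ∧ (up s ∈ ν.part.parts ∨ upLast s ∈ ν.part.parts) := by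
  simp [restrict, Finpartition.ofExistsUnique]

lemma mem_restrict_opens {ν : MarkedPartition (n + 1)} {s : Finset (Fin n)} :
    s ∈ ν.restrict.opens ↔ s ≠ ∅ ∧ (up s ∈ ν.opens ∨ upLast s ∈ ν.part.parts) := by
  simp [restrict]

lemma extendMap_surjective (n : ℕ) : Function.Surjective (extendMap n) := by
  intro ν
  obtain ⟨t, ht, hlt⟩ := ν.part.exists_mem (mem_univ (Fin.last n))
  obtain ⟨b, rfl⟩ : ∃ b, upLast b = t := ⟨down t, upLast_down hlt⟩
  have hb : b ∈ insert ∅ ν.restrict.opens := by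
    by_cases h : b = ∅ <;> simp [h, mem_restrict_opens, ht]
  have hlast (s : Finset (Fin n)) : upLast s ∈ ν.part.parts ↔ s = b :=
    ⟨fun h => upLast_injective (ν.eq_of_mem h ht (last_mem_upLast s) hlt), fun h => h ▸ ht⟩
  have hup (s : Finset (Fin n)) (h : up s ∈ ν.part.parts) : s ≠ ∅ ∧ s ≠ b := by
    have hs : s.Nonempty := by
      obtain ⟨x, hx⟩ := ν.part.nonempty_of_mem_parts h
      revert hx
      exact Fin.lastCases (by simp) (fun x hx => ⟨x, castSucc_mem_up.1 hx⟩) x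
    refine ⟨hs.ne_empty, ?_⟩
    rintro rfl
    obtain ⟨x, hx⟩ := hs
    exact up_ne_upLast s s
      (ν.eq_of_mem h ht (castSucc_mem_up.2 hx) (castSucc_mem_upLast.2 hx))
  refine ⟨⟨ν.restrict, ⟨b, hb⟩, decide (upLast b ∈ ν.opens)⟩, ?_⟩
  ext t
  · by_cases hl : Fin.last n ∈ t
    · rw [← upLast_down hl, hlast]
      exact mem_extendParts_upLast
    · rw [← up_down hl]
      refine mem_extendParts_up.trans ?_
      rw [mem_restrict_parts, hlast]
      have := hup (down t)
      tauto
  · have hopen (s : Finset (Fin n)) (h : upLast s ∈ ν.opens) := (hlast s).1 (ν.opens_subset h)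
    by_cases hl : Fin.last n ∈ t
    · rw [← upLast_down hl]
      by_cases h : upLast b ∈ ν.opens
      · simp only [extendMap, extend_opens, h, decide_true, if_true, mem_extendParts_upLast]
        exact ⟨fun e => e ▸ h, hopen _⟩
      · simp only [extendMap, extend_opens, h, decide_false, Bool.false_eq_true, if_false]
        simp only [upLast_notMem_image_up, false_iff]
        exact fun h' => h (hopen _ h' ▸ h')
    · rw [← up_down hl]
      have h₁ : up (down t) ∈ (extendMap n ⟨ν.restrict, ⟨b, hb⟩,
          decide (upLast b ∈ ν.opens)⟩).opens ↔ down t ≠ b ∧ down t ∈ ν.restrict.opens := by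
        by_cases h : upLast b ∈ ν.opens <;>
          simp [extendMap, extend_opens, h, extendParts, up_injective.eq_iff]
      rw [h₁, mem_restrict_opens, hlast]
      have := fun h => hup (down t) (ν.opens_subset h)
      tauto

lemma extendMap_bijective (n : ℕ) : Function.Bijective (extendMap n) :=
  ⟨extendMap_injective n, extendMap_surjective n⟩

lemma fdim_eq_sum (n : ℕ) (A B : ℤ) :
    (fdim n A B : ℤ) = ∑ μ : MarkedPartition n, if (μ.o : ℤ) = A ∧ μ.dtilde = B then 1 else 0 := by
  rw [fdim, Nat.card_eq_fintype_card, Fintype.card_subtype, Finset.sum_boole]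

lemma sum_extension (μ : MarkedPartition n) (A B : ℤ) :
    (∑ d : {b : Finset (Fin n) // b ∈ insert ∅ μ.opens} × Bool,
      if ((μ.extend d.1.1 d.1.2 d.2).o : ℤ) = A ∧ (μ.extend d.1.1 d.1.2 d.2).dtilde = B
        then (1 : ℤ) else 0) =
      (if (μ.o : ℤ) = A - 1 ∧ μ.dtilde = B - A + 1 then 1 else 0)
        + (if (μ.o : ℤ) = A ∧ μ.dtilde = B - A then 1 else 0)
        + A * (if (μ.o : ℤ) = A ∧ μ.dtilde = B - A + 1 then 1 else 0)
        + (A + 1) * (if (μ.o : ℤ) = A + 1 ∧ μ.dtilde = B - A then 1 else 0) := by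
  have hval (b : {b : Finset (Fin n) // b ∈ insert ∅ μ.opens}) :
      (∑ c : Bool, if ((μ.extend b.1 b.2 c).o : ℤ) = A ∧ (μ.extend b.1 b.2 c).dtilde = B
        then (1 : ℤ) else 0) =
      if b.1 = ∅ then
        (if (μ.o : ℤ) = A - 1 ∧ μ.dtilde = B - A + 1 then 1 else 0)
          + (if (μ.o : ℤ) = A ∧ μ.dtilde = B - A then 1 else 0)
      else (if (μ.o : ℤ) = A ∧ μ.dtilde = B - A + 1 then 1 else 0)
        + (if (μ.o : ℤ) = A + 1 ∧ μ.dtilde = B - A then 1 else 0) := by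
    obtain ⟨b, hb⟩ := b
    rw [Fintype.sum_bool]
    by_cases h : b = ∅
    · subst h
      simp only [o_extend_empty, dtilde_extend_empty, if_true, Bool.false_eq_true, if_false]
      congr 2 <;> apply propext <;> omega
    · have hb' : b ∈ μ.opens := (mem_insert.1 hb).resolve_left h
      simp only [o_extend_of_mem _ _ _ _ hb', dtilde_extend_of_mem _ _ _ _ hb', h, if_true,
        Bool.false_eq_true, if_false]
      congr 2 <;> apply propext <;> omega
  have hmul (C D : ℤ) : (μ.o : ℤ) * (if (μ.o : ℤ) = C ∧ μ.dtilde = D then 1 else 0) =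
      C * (if (μ.o : ℤ) = C ∧ μ.dtilde = D then 1 else 0) := by
    split_ifs with h
    · rw [h.1]
    · simp
  rw [Fintype.sum_prod_type]
  simp only [hval]
  rw [Finset.sum_coe_sort (insert ∅ μ.opens) fun b => if b = ∅ then
        (if (μ.o : ℤ) = A - 1 ∧ μ.dtilde = B - A + 1 then (1 : ℤ) else 0)
          + (if (μ.o : ℤ) = A ∧ μ.dtilde = B - A then 1 else 0)
      else (if (μ.o : ℤ) = A ∧ μ.dtilde = B - A + 1 then 1 else 0)
        + (if (μ.o : ℤ) = A + 1 ∧ μ.dtilde = B - A then 1 else 0),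
    sum_insert μ.empty_notMem_opens, if_pos rfl,
    sum_congr rfl fun b hb => if_neg (by rintro rfl; exact μ.empty_notMem_opens hb),
    sum_const, nsmul_eq_mul, mul_add, ← add_assoc]
  change _ + (μ.o : ℤ) * _ + (μ.o : ℤ) * _ = _
  rw [hmul, hmul]

end MarkedPartition

/-- The recursion for `f(n; A, B)`:
`f(n;A,B) = f(n-1;A-1,B-A+1) + f(n-1;A,B-A) + A·f(n-1;A,B-A+1) + (A+1)·f(n-1;A+1,B-A)`. -/
theorem fdim_recursion (n : ℕ) (hn : 1 ≤ n) (A B : ℤ) (hA : 0 ≤ A) :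
    (fdim n A B : ℤ) =
      (fdim (n - 1) (A - 1) (B - A + 1) : ℤ) + (fdim (n - 1) A (B - A) : ℤ)
        + A * (fdim (n - 1) A (B - A + 1) : ℤ)
        + (A + 1) * (fdim (n - 1) (A + 1) (B - A) : ℤ) := by
  obtain ⟨n, rfl⟩ := Nat.exists_eq_add_of_le' hn
  simp only [Nat.add_sub_cancel, MarkedPartition.fdim_eq_sum, mul_sum, ← sum_add_distrib]
  rw [← (MarkedPartition.extendMap_bijective n).sum_comp, Fintype.sum_sigma]
  exact sum_congr rfl fun μ _ => μ.sum_extension A B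
end

section
/- Let r, d, k, s be nonnegative integers and define g_{r,d,k,s}(n) := n^d · Σ_{i=0}^{n−k} C(n−k,i)·B_{i+s}·r^{n−k−i} for n ≥ k. Then g_{r,d,k,s} is a shifted Bell polynomial with lower shift index −k and upper shift index r+s−k: there exist polynomials Q_j ∈ ℚ[x] for −k ≤ j ≤ r+s−k such that for all n ≥ k, g_{r,d,k,s}(n) = Σ_{j=−k}^{r+s−k} Q_j(n)·B_{n+j}. -/
open Finset

/-- `g_{r,d,k,s}(n) = n^d · Σ_{i=0}^{n-k} C(n-k,i) · B_{i+s} · r^{n-k-i}`. -/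
noncomputable def gBell (r d k s : ℕ) (n : ℕ) : ℚ :=
  (n : ℚ) ^ d * ∑ i ∈ Finset.range (n - k + 1),
    ((n - k).choose i : ℚ) * (bell (i + s) : ℚ) * (r : ℚ) ^ (n - k - i)

namespace Finpartition

/-- The partition of `insert a s` obtained from a subset `t` of `s` and a partition of `t` by adding
the part `insert a (s \ t)`. -/
def insertPart {α : Type*} [DecidableEq α] {a : α} {s : Finset α} (ha : a ∉ s)
    (x : (t : s.powerset) × Finpartition t.1) : Finpartition (insert a s) :=
  x.2.extend (b := insert a (s \ x.1.1)) (insert_ne_empty _ _)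
    (disjoint_insert_right.2
      ⟨fun h ↦ ha (mem_powerset.1 x.1.2 h), disjoint_sdiff⟩)
    (by
      change x.1.1 ∪ insert a (s \ x.1.1) = insert a s
      rw [union_insert, union_sdiff_of_subset (mem_powerset.1 x.1.2)])

theorem insertPart_bijective {α : Type*} [DecidableEq α] {a : α} {s : Finset α} (ha : a ∉ s) :
    Function.Bijective (insertPart ha) := by
  have not_mem_part {t : Finset α} (ht : t ⊆ s) (P : Finpartition t) {u : Finset α}
      (hu : u ∈ P.parts) : a ∉ u := fun h ↦ ha (ht (P.subset hu h))
  constructor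
  · rintro ⟨⟨t, ht⟩, P⟩ ⟨⟨u, hu⟩, Q⟩ h
    rw [mem_powerset] at ht hu
    have hparts : insert (insert a (s \ t)) P.parts = insert (insert a (s \ u)) Q.parts :=
      congrArg Finpartition.parts h
    have hmem : insert a (s \ t) ∈ insert (insert a (s \ u)) Q.parts :=
      hparts ▸ mem_insert_self _ _
    have heq : insert a (s \ t) = insert a (s \ u) :=
      (mem_insert.1 hmem).resolve_right fun h' ↦ not_mem_part hu Q h' (mem_insert_self _ _)
    have hsdiff : s \ t = s \ u := by
      have := congrArg (fun v ↦ v.erase a) heq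
      simpa [erase_insert, ha] using this
    obtain rfl : t = u := by
      rw [← Finset.sdiff_sdiff_eq_self ht, hsdiff, Finset.sdiff_sdiff_eq_self hu]
    have hPQ : P.parts = Q.parts := by
      have := congrArg (fun v ↦ v.erase (insert a (s \ t))) hparts
      simpa only [erase_insert fun h' ↦ not_mem_part ht P h' (mem_insert_self _ _),
        erase_insert fun h' ↦ not_mem_part ht Q h' (mem_insert_self _ _)] using this
    obtain rfl : P = Q := Finpartition.ext hPQ
    rfl
  · intro P
    have hab : a ∈ P.part a := P.mem_part (mem_insert_self a s)
    have hb : P.part a ∈ P.parts := P.part_mem.2 (mem_insert_self a s)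
    have hsup : (P.parts.erase (P.part a)).sup id = s \ P.part a := by
      ext x
      simp only [mem_sup, mem_erase, id, mem_sdiff]
      constructor
      · rintro ⟨u, ⟨hne, hu⟩, hx⟩
        have hxb : x ∉ P.part a := fun h ↦ hne (P.eq_of_mem_parts hu hb hx h)
        refine ⟨(mem_insert.1 (P.subset hu hx)).resolve_left ?_, hxb⟩
        rintro rfl
        exact hxb hab
      · rintro ⟨hx, hxb⟩
        obtain ⟨u, hu, hxu⟩ := P.exists_mem (mem_insert_of_mem hx)
        refine ⟨u, ⟨?_, hu⟩, hxu⟩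
        rintro rfl
        exact hxb hxu
    refine ⟨⟨⟨s \ P.part a, mem_powerset.2 sdiff_subset⟩,
      P.ofSubset (erase_subset _ _) hsup⟩, Finpartition.ext ?_⟩
    change insert (insert a (s \ (s \ P.part a))) (P.parts.erase (P.part a)) = P.parts
    have : insert a (s \ (s \ P.part a)) = P.part a := by
      rw [sdiff_sdiff_right_self, inf_eq_inter, ← insert_inter_of_mem hab]
      exact inter_eq_right.2 (P.subset hb)
    rw [this, insert_erase hb]

/-- The partitions of a finset are counted by the Bell numbers. -/
theorem card_eq_bell {α : Type*} [DecidableEq α] (s : Finset α) :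
    Fintype.card (Finpartition s) = Nat.bell #s := by
  induction s using Finset.strongInduction with
  | H s ih =>
    obtain rfl | ⟨a, ha⟩ := s.eq_empty_or_nonempty
    · rw [card_empty, Nat.bell_zero]
      exact Fintype.card_unique (α := Finpartition (⊥ : Finset α))
    · obtain ⟨s, has, rfl⟩ : ∃ u, a ∉ u ∧ insert a u = s :=
        ⟨s.erase a, notMem_erase a s, insert_erase ha⟩
      rw [← Fintype.card_of_bijective (insertPart_bijective has), Fintype.card_sigma,
        sum_coe_sort s.powerset fun t ↦ Fintype.card (Finpartition t),
        sum_congr rfl fun t ht ↦ ih t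
          ((mem_powerset.1 ht).trans_ssubset (ssubset_insert has)),
        sum_powerset_apply_card, card_insert_of_notMem has, Nat.bell_succ',
        Nat.sum_antidiagonal_eq_sum_range_succ fun i j ↦ (#s).choose i * j.bell,
        ← sum_range_reflect]
      refine sum_congr rfl fun i hi ↦ ?_
      have hi : i ≤ #s := Nat.lt_succ_iff.1 (mem_range.1 hi)
      rw [smul_eq_mul, Nat.add_sub_cancel, Nat.choose_symm hi]

end Finpartition

theorem bell_eq_natBell (n : ℕ) : bell n = Nat.bell n := by
  rw [bell, Finpartition.card_eq_bell, card_univ, Fintype.card_fin]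

theorem bell_succ_eq_sum_range (n : ℕ) :
    bell (n + 1) = ∑ i ∈ range (n + 1), n.choose i * bell i := by
  simp_rw [bell_eq_natBell]
  rw [Nat.bell_succ', Nat.sum_antidiagonal_eq_sum_range_succ fun i j ↦ n.choose i * j.bell,
    ← sum_range_reflect]
  refine sum_congr rfl fun i hi ↦ ?_
  have hi : i ≤ n := Nat.lt_succ_iff.1 (mem_range.1 hi)
  rw [Nat.succ_sub_one, Nat.choose_symm hi, Nat.sub_sub_self hi]

open Polynomial

/-- The linear functional on `ℚ[X]` sending `X ^ n` to the `n`-th Bell number. -/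
noncomputable def bellFunctional : ℚ[X] →ₗ[ℚ] ℚ :=
  Polynomial.lsum fun n ↦ (bell n : ℚ) • LinearMap.id

theorem bellFunctional_C_mul_X_pow (c : ℚ) (n : ℕ) :
    bellFunctional (C c * X ^ n) = c * bell n := by
  rw [bellFunctional, lsum_apply, C_mul_X_pow_eq_monomial, sum_monomial_index _ _ (by simp),
    LinearMap.smul_apply, LinearMap.id_apply, smul_eq_mul, mul_comm]

theorem bellFunctional_X_mul (p : ℚ[X]) :
    bellFunctional (X * p) = bellFunctional (p.comp (X + 1)) := by
  induction p using Polynomial.induction_on' with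
  | add p q hp hq => rw [mul_add, map_add, hp, hq, add_comp, map_add]
  | monomial n c =>
    rw [← C_mul_X_pow_eq_monomial, mul_left_comm, ← pow_succ', bellFunctional_C_mul_X_pow,
      bell_succ_eq_sum_range, mul_comp, C_comp, X_pow_comp, add_pow, C_mul', map_smul, map_sum,
      smul_eq_mul, Nat.cast_sum]
    congr 1
    refine sum_congr rfl fun i _ ↦ ?_
    rw [one_pow, mul_one, mul_comm (X ^ i), ← map_natCast (C : ℚ →+* ℚ[X]),
      bellFunctional_C_mul_X_pow, Nat.cast_mul]

theorem bellFunctional_descPochhammer_mul (r : ℕ) (p : ℚ[X]) :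
    bellFunctional (descPochhammer ℚ r * p) = bellFunctional (p.comp (X + C (r : ℚ))) := by
  induction r generalizing p with
  | zero => simp
  | succ r ih =>
    rw [descPochhammer_succ_left, mul_assoc, bellFunctional_X_mul, mul_comp, comp_assoc,
      show (X - 1 : ℚ[X]).comp (X + 1) = X by simp, comp_X, ih, comp_assoc]
    congr 2
    simp [add_assoc]

theorem bellFunctional_mul_X_pow {p : ℚ[X]} {N : ℕ} (hp : p.natDegree < N) (m : ℕ) :
    bellFunctional (p * X ^ m) = ∑ i ∈ range N, p.coeff i * bell (m + i) := by
  conv_lhs => rw [p.as_sum_range' N hp]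
  rw [sum_mul, map_sum]
  refine sum_congr rfl fun i _ ↦ ?_
  rw [← C_mul_X_pow_eq_monomial, mul_assoc, ← pow_add, bellFunctional_C_mul_X_pow, add_comm i]

theorem sum_choose_mul_bell_mul_pow (r s m : ℕ) :
    ∑ i ∈ range (m + 1), (m.choose i : ℚ) * (bell (i + s) : ℚ) * (r : ℚ) ^ (m - i) =
      ∑ i ∈ range (r + s + 1),
        (descPochhammer ℚ r * (X - C (r : ℚ)) ^ s).coeff i * (bell (m + i) : ℚ) := by
  rw [← bellFunctional_mul_X_pow, mul_assoc, bellFunctional_descPochhammer_mul]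
  · have : ((X - C (r : ℚ)) ^ s * X ^ m).comp (X + C (r : ℚ)) =
        ∑ i ∈ range (m + 1), C ((m.choose i : ℚ) * (r : ℚ) ^ (m - i)) * X ^ (i + s) := by
      simp only [mul_comp, pow_comp, sub_comp, X_comp, natCast_comp, add_sub_cancel_right, add_pow,
        mul_sum, map_mul, map_pow, map_natCast]
      exact sum_congr rfl fun i _ ↦ by ring
    rw [this, map_sum]
    refine sum_congr rfl fun i _ ↦ ?_
    rw [bellFunctional_C_mul_X_pow]
    ring
  · rw [Nat.lt_succ_iff]
    refine natDegree_mul_le.trans ?_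
    rw [descPochhammer_natDegree, natDegree_pow, natDegree_X_sub_C, mul_one]

/-- `g_{r,d,k,s}` is a shifted Bell polynomial with lower shift index `-k` and upper
shift index `r + s - k`. -/
theorem gBell_shiftedBell (r d k s : ℕ) :
    ∃ Q : ℤ → Polynomial ℚ,
      ∀ n : ℕ, k ≤ n →
        gBell r d k s n =
          ∑ j ∈ Finset.Icc (-(k : ℤ)) ((r : ℤ) + (s : ℤ) - (k : ℤ)),
            (Q j).eval (n : ℚ) * (bell ((n : ℤ) + j).toNat : ℚ) := by
  refine ⟨fun j ↦ X ^ d *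
    C ((descPochhammer ℚ r * (X - C (r : ℚ)) ^ s).coeff (j + k).toNat), fun n hn ↦ ?_⟩
  rw [gBell, sum_choose_mul_bell_mul_pow, mul_sum]
  refine sum_bij' (fun i _ ↦ (i : ℤ) - k) (fun j _ ↦ (j + k).toNat) ?_ ?_ ?_ ?_ ?_
  · intro i hi
    rw [mem_range] at hi
    rw [mem_Icc]
    lia
  · intro j hj
    rw [mem_Icc] at hj
    rw [mem_range]
    lia
  · intro i _
    lia
  · intro j hj
    rw [mem_Icc] at hj
    lia
  · intro i _
    beta_reduce
    rw [sub_add_cancel, Int.toNat_natCast, show ((n : ℤ) + (i - k)).toNat = n - k + i by lia,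
      eval_mul, eval_pow, eval_X, eval_C, mul_assoc]
end

section
/- For all integers s ≥ 0 and n ≥ 0, B_{n+s} = Σ_{a=0}^{s} S(s,a) · Σ_{i=0}^{n} C(n,i) · a^{n−i} · B_i, where S(s,a) is the Stirling number of the second kind, C(n,i) the binomial coefficient, and 0^0 is interpreted as 1. -/
open Finset

/-- The Stirling number of the second kind `S(s, a)`: the number of set partitions of
an `s`-element set into exactly `a` blocks. -/
def stirling (s a : ℕ) : ℕ :=
  Fintype.card {P : SetPartition s // P.parts.card = a}

namespace Finpartition

variable {α : Type*} [DecidableEq α] {s : Finset α} {a : α}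

/-- Adds `a` to the block `c` of `P`, or as a new singleton block if `c = ∅`. -/
def insertInto (P : Finpartition s) (ha : a ∉ s) {c : Finset α} (hc : c ∈ insert ∅ P.parts) :
    Finpartition (insert a s) where
  parts := insert (insert a c) (P.parts.erase c)
  supIndep := by
    rw [supIndep_iff_pairwiseDisjoint, coe_insert,
      Set.pairwiseDisjoint_insert_of_notMem]
    · refine ⟨P.disjoint.subset (by simp), fun b hb => ?_⟩
      simp only [coe_erase, Set.mem_sdiff, mem_coe, Set.mem_singleton_iff] at hb
      simp only [id, disjoint_insert_left]
      refine ⟨fun h => ha (P.subset hb.1 h), ?_⟩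
      rcases mem_insert.1 hc with rfl | hc
      · simp
      · exact P.disjoint hc hb.1 (Ne.symm hb.2)
    · intro h
      exact ha (P.subset (mem_of_mem_erase (mem_coe.1 h)) (mem_insert_self a c))
  sup_parts := by
    have h : c ∪ (P.parts.erase c).sup id = s := by
      rcases mem_insert.1 hc with rfl | hc
      · rw [erase_eq_of_notMem P.empty_notMem_parts, P.sup_parts, empty_union]
      · conv_rhs => rw [← P.sup_parts, ← insert_erase hc, sup_insert]
        rfl
    rw [sup_insert, id, sup_eq_union, insert_union, h]
  bot_notMem := by
    simp only [bot_eq_empty, mem_insert, mem_erase, not_or]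
    exact ⟨(insert_ne_empty _ _).symm, fun h => P.empty_notMem_parts h.2⟩

/-- Removes `a` from its block. -/
def removeElem (Q : Finpartition (insert a s)) (ha : a ∉ s) : Finpartition s :=
  (Q.avoid {a}).copy (by rw [sdiff_singleton_eq_erase, erase_insert ha])

theorem mem_removeElem (Q : Finpartition (insert a s)) (ha : a ∉ s) {d : Finset α} :
    d ∈ (Q.removeElem ha).parts ↔
      d ≠ ∅ ∧ (d = (Q.part a).erase a ∨ d ∈ Q.parts ∧ a ∉ d) := by
  have hpart : Q.part a ∈ Q.parts := Q.part_mem.2 (mem_insert_self a s)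
  have hmem : a ∈ Q.part a := Q.mem_part_self.2 (mem_insert_self a s)
  simp only [removeElem, copy_parts, avoid, ofErase_parts, mem_erase, mem_image,
    sdiff_singleton_eq_erase, bot_eq_empty]
  refine and_congr_right fun _ => ⟨?_, ?_⟩
  · rintro ⟨e, he, rfl⟩
    by_cases hae : a ∈ e
    · exact Or.inl (by rw [Q.part_eq_of_mem he hae])
    · exact Or.inr (by rw [erase_eq_of_notMem hae]; exact ⟨he, hae⟩)
  · rintro (rfl | ⟨hd, had⟩)
    · exact ⟨_, hpart, rfl⟩
    · exact ⟨d, hd, erase_eq_of_notMem had⟩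

theorem part_insertInto (P : Finpartition s) (ha : a ∉ s) {c : Finset α}
    (hc : c ∈ insert ∅ P.parts) : (P.insertInto ha hc).part a = insert a c :=
  part_eq_of_mem _ (mem_insert_self _ _) (mem_insert_self _ _)

theorem notMem_of_mem_insert_empty (P : Finpartition s) (ha : a ∉ s) {c : Finset α}
    (hc : c ∈ insert ∅ P.parts) : a ∉ c := by
  rcases mem_insert.1 hc with rfl | hc
  · simp
  · exact fun h => ha (P.subset hc h)

theorem removeElem_insertInto (P : Finpartition s) (ha : a ∉ s) {c : Finset α}
    (hc : c ∈ insert ∅ P.parts) : (P.insertInto ha hc).removeElem ha = P := by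
  have hac := P.notMem_of_mem_insert_empty ha hc
  ext d : 2
  rw [mem_removeElem, part_insertInto, erase_insert hac]
  have h0 := P.empty_notMem_parts
  have had : d ∈ P.parts → a ∉ d := fun hd h => ha (P.subset hd h)
  simp only [insertInto, mem_insert, mem_erase] at hc ⊢
  grind

theorem erase_part_mem (Q : Finpartition (insert a s)) (ha : a ∉ s) :
    (Q.part a).erase a ∈ insert ∅ (Q.removeElem ha).parts := by
  rw [mem_insert, mem_removeElem]
  tauto

theorem insertInto_removeElem (Q : Finpartition (insert a s)) (ha : a ∉ s) :
    (Q.removeElem ha).insertInto ha (Q.erase_part_mem ha) = Q := by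
  have hpart : Q.part a ∈ Q.parts := Q.part_mem.2 (mem_insert_self a s)
  have hmem : a ∈ Q.part a := Q.mem_part_self.2 (mem_insert_self a s)
  ext d : 2
  simp only [insertInto, mem_insert, mem_erase, mem_removeElem, insert_erase hmem]
  constructor
  · rintro (rfl | ⟨h1, -, h2 | h2⟩)
    · exact hpart
    · exact absurd h2 h1
    · exact h2.1
  · intro hd
    by_cases had : a ∈ d
    · exact Or.inl (Q.part_eq_of_mem hd had).symm
    · refine Or.inr ⟨?_, Q.ne_empty hd, Or.inr ⟨hd, had⟩⟩
      rintro rfl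
      obtain ⟨x, hx⟩ := Q.nonempty_of_mem_parts hd
      exact had ((Q.eq_of_mem_parts hd hpart hx (mem_of_mem_erase hx)).symm ▸ hmem)

theorem card_insertInto (P : Finpartition s) (ha : a ∉ s) {c : Finset α}
    (hc : c ∈ insert ∅ P.parts) :
    #(P.insertInto ha hc).parts = #(P.parts.erase c) + 1 :=
  card_insert_of_notMem fun h =>
    ha (P.subset (mem_of_mem_erase h) (mem_insert_self a c))

/-- A partition with `k` blocks extends to a further element in `k` ways keeping the number of
blocks, and in one way with `k + 1` blocks. -/
theorem sum_card_parts_insert (ha : a ∉ s) (u : ℕ → ℕ) :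
    ∑ Q : Finpartition (insert a s), u #Q.parts =
      ∑ P : Finpartition s, (#P.parts * u #P.parts + u (#P.parts + 1)) := by
  rw [← sum_fiberwise univ (fun Q : Finpartition (insert a s) => Q.removeElem ha)]
  refine sum_congr rfl fun P _ => ?_
  have key : ∑ Q : Finpartition (insert a s) with Q.removeElem ha = P, u #Q.parts =
      ∑ c ∈ insert ∅ P.parts, u (#(P.parts.erase c) + 1) := by
    refine sum_bij' (fun Q _ => (Q.part a).erase a) (fun c hc => P.insertInto ha hc) ?_ ?_ ?_ ?_ ?_
    · rintro Q hQ
      obtain rfl := (mem_filter.1 hQ).2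
      exact Q.erase_part_mem ha
    · intro c hc
      simp [removeElem_insertInto]
    · rintro Q hQ
      obtain rfl := (mem_filter.1 hQ).2
      exact Q.insertInto_removeElem ha
    · intro c hc
      simp only [part_insertInto, erase_insert (P.notMem_of_mem_insert_empty ha hc)]
    · rintro Q hQ
      obtain rfl := (mem_filter.1 hQ).2
      rw [← card_insertInto _ ha (Q.erase_part_mem ha), insertInto_removeElem]
  rw [key, sum_insert P.empty_notMem_parts, erase_eq_of_notMem P.empty_notMem_parts, add_comm,
    sum_congr rfl fun c hc => by rw [card_erase_add_one hc], sum_const, smul_eq_mul]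

end Finpartition

/-- The number of ways to extend a set partition with `k` blocks by `n` further elements. -/
def extensionCount : ℕ → ℕ → ℕ
  | 0, _ => 1
  | n + 1, k => k * extensionCount n k + extensionCount n (k + 1)

theorem sum_extensionCount {α : Type*} [DecidableEq α] (s : Finset α) (n : ℕ) :
    ∑ P : Finpartition s, extensionCount n #P.parts = extensionCount (n + #s) 0 := by
  induction s using Finset.induction_on generalizing n with
  | empty =>
    have : Unique (Finpartition (∅ : Finset α)) :=
      inferInstanceAs (Unique (Finpartition (⊥ : Finset α)))
    have h (P : Finpartition (∅ : Finset α)) : #P.parts = 0 := by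
      simp [P.parts_eq_empty_iff]
    simp [h]
  | insert a s ha ih =>
    rw [Finpartition.sum_card_parts_insert ha, card_insert_of_notMem ha, add_left_comm, add_comm #s,
      ← ih]
    rfl

theorem bell_eq_extensionCount (n : ℕ) : bell n = extensionCount n 0 := by
  have h := sum_extensionCount (univ : Finset (Fin n)) 0
  simpa [extensionCount, bell] using h

/-- Each of `n` new elements either joins one of `a` distinguished blocks or takes part in an
extension of the remaining `k` blocks. -/
theorem extensionCount_add (n k a : ℕ) :
    extensionCount n (k + a) =
      ∑ i ∈ range (n + 1), n.choose i * a ^ (n - i) * extensionCount i k := by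
  induction n generalizing k with
  | zero => simp [extensionCount]
  | succ n ih =>
    have hstep : extensionCount (n + 1) (k + a) =
        ∑ i ∈ range (n + 1), n.choose i * a ^ (n - i) *
          (a * extensionCount i k + extensionCount (i + 1) k) := by
      rw [extensionCount, add_right_comm, ih, ih, mul_sum, ← sum_add_distrib]
      refine sum_congr rfl fun i _ => ?_
      rw [extensionCount]
      ring
    rw [hstep, sum_range_succ' _ (n + 1)]
    simp only [mul_add, sum_add_distrib, Nat.choose_succ_succ, add_mul, Nat.add_sub_add_right]
    rw [add_comm, add_assoc]
    congr 1
    rw [sum_range_succ', sum_range_succ _ n, Nat.choose_succ_self]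
    simp only [zero_mul, add_zero, Nat.choose_zero_right, Nat.sub_zero]
    congr 1
    · refine sum_congr rfl fun i hi => ?_
      obtain ⟨d, rfl⟩ := Nat.exists_eq_add_of_lt (mem_range.1 hi)
      rw [show i + d + 1 - (i + 1) = d by omega, show i + d + 1 - i = d + 1 by omega]
      ring
    · ring

theorem sum_stirling_mul (s : ℕ) (u : ℕ → ℕ) :
    ∑ a ∈ range (s + 1), stirling s a * u a = ∑ P : SetPartition s, u #P.parts := by
  have hmaps : ∀ P ∈ (univ : Finset (SetPartition s)), #P.parts ∈ range (s + 1) := fun P _ =>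
    mem_range.2 (Nat.lt_succ_of_le (by simpa using P.card_parts_le_card))
  rw [← sum_fiberwise_of_maps_to hmaps]
  refine sum_congr rfl fun a _ => ?_
  rw [sum_congr rfl fun P hP => by rw [(mem_filter.1 hP).2], sum_const, smul_eq_mul, stirling,
    Fintype.card_subtype]

/-- `B_{n+s} = Σ_{a=0}^{s} S(s,a) · Σ_{i=0}^{n} C(n,i) · a^{n-i} · B_i`. -/
theorem bell_add_eq_stirling_sum (s n : ℕ) :
    bell (n + s) =
      ∑ a ∈ Finset.range (s + 1),
        stirling s a * ∑ i ∈ Finset.range (n + 1), n.choose i * a ^ (n - i) * bell i := by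
  simp only [bell_eq_extensionCount]
  rw [← sum_congr rfl fun a _ => congrArg _ ((congrArg _ (zero_add a)).symm.trans
    (extensionCount_add n 0 a)), sum_stirling_mul, sum_extensionCount, card_univ, Fintype.card_fin]
end
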